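/- arXiv:2507.17528 — 3 statements merged into one kernel-verified Lean document; each statement's English description precedes it below -/
import Mathlib

section
/- Let d1, d2, r, n be positive natural numbers, let W be a real d1×r matrix, H a real d2×r matrix, X̃ a real n×(d1·d2) matrix, L a real n×n matrix, and let a, α, λ be real numbers. Let L_h = λ·I (d2×d2) and suppose L_w is a real d1×d1 matrix satisfying I_r ⊗ L_w = 2aα·(Hᵀ ⊗ I_{d1})·X̃ᵀ L X̃·(H ⊗ I_{d1}) + λ·I_{r·d1}. Then (λ/2)(‖W‖_F² + ‖H‖_F²) + aα·vec(W Hᵀ)ᵀ (X̃ᵀ L X̃) vec(W Hᵀ) = (1/2)·tr(Hᵀ L_h H) + (1/2)·tr(Wᵀ L_w W). -/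
open Matrix Kronecker

/-- Column-stacking vectorization of a `d1 × d2` real matrix:
`vecCol M (j, i) = M i j`, i.e. the columns of `M` are stacked. -/
def vecCol {d1 d2 : ℕ} (M : Matrix (Fin d1) (Fin d2) ℝ) : Fin d2 × Fin d1 → ℝ :=
  fun p => M p.2 p.1

/-- Squared Frobenius norm of a real matrix. -/
def frobSq {d1 d2 : ℕ} (M : Matrix (Fin d1) (Fin d2) ℝ) : ℝ :=
  ∑ i, ∑ j, (M i j) ^ 2

theorem vecCol_eq_vec {d1 d2 : ℕ} (M : Matrix (Fin d1) (Fin d2) ℝ) : vecCol M = vec M := rfl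

theorem frobSq_eq_trace {d1 d2 : ℕ} (M : Matrix (Fin d1) (Fin d2) ℝ) :
    frobSq M = trace (Mᵀ * M) := by
  simp only [frobSq, trace, diag, mul_apply, transpose_apply, sq]
  exact Finset.sum_comm

/-- the core algebraic identity behind Lemma 1: with `L_h = λ·I` and
`I_r ⊗ L_w = 2aα (Hᵀ ⊗ I) X̃ᵀ L X̃ (H ⊗ I) + λ I`, one has
`(λ/2)(‖W‖_F² + ‖H‖_F²) + aα vec(WHᵀ)ᵀ (X̃ᵀLX̃) vec(WHᵀ)
  = (1/2) tr(Hᵀ L_h H) + (1/2) tr(Wᵀ L_w W)`. -/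
theorem stmt0 (d1 d2 r n : ℕ) (hd1 : 0 < d1) (hd2 : 0 < d2) (hr : 0 < r) (hn : 0 < n)
    (W : Matrix (Fin d1) (Fin r) ℝ) (H : Matrix (Fin d2) (Fin r) ℝ)
    (Xt : Matrix (Fin n) (Fin d2 × Fin d1) ℝ) (L : Matrix (Fin n) (Fin n) ℝ)
    (a α lam : ℝ)
    (Lh : Matrix (Fin d2) (Fin d2) ℝ)
    (hLh : Lh = lam • (1 : Matrix (Fin d2) (Fin d2) ℝ))
    (Lw : Matrix (Fin d1) (Fin d1) ℝ)
    (hLw : (1 : Matrix (Fin r) (Fin r) ℝ) ⊗ₖ Lw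
        = (2 * a * α) • ((Hᵀ ⊗ₖ (1 : Matrix (Fin d1) (Fin d1) ℝ)) * (Xtᵀ * L * Xt) *
            (H ⊗ₖ (1 : Matrix (Fin d1) (Fin d1) ℝ)))
          + lam • (1 : Matrix (Fin r × Fin d1) (Fin r × Fin d1) ℝ)) :
    lam / 2 * (frobSq W + frobSq H)
      + a * α * (vecCol (W * Hᵀ) ⬝ᵥ ((Xtᵀ * L * Xt) *ᵥ vecCol (W * Hᵀ)))
    = 1 / 2 * Matrix.trace (Hᵀ * Lh * H) + 1 / 2 * Matrix.trace (Wᵀ * Lw * W) := by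
  have quadratic_Lw : vec W ⬝ᵥ (((1 : Matrix (Fin r) (Fin r) ℝ) ⊗ₖ Lw) *ᵥ vec W)
      = trace (Wᵀ * Lw * W) := by
    rw [← vec_mul_eq_mulVec, vec_dotProduct_vec, Matrix.mul_assoc]
  have vec_left : vec W ᵥ* (Hᵀ ⊗ₖ (1 : Matrix (Fin d1) (Fin d1) ℝ)) = vec (W * Hᵀ) :=
    (vec_mul_eq_vecMul W Hᵀ).symm
  have vec_right : (H ⊗ₖ (1 : Matrix (Fin d1) (Fin d1) ℝ)) *ᵥ vec W = vec (W * Hᵀ) := by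
    rw [kronecker_mulVec_vec, Matrix.one_mul]
  rw [hLw, add_mulVec, smul_mulVec, smul_mulVec, one_mulVec, dotProduct_add, dotProduct_smul,
    dotProduct_smul, ← mulVec_mulVec, vec_right, ← mulVec_mulVec, dotProduct_mulVec, vec_left,
    vec_dotProduct_vec W W, smul_eq_mul, smul_eq_mul] at quadratic_Lw
  rw [← quadratic_Lw, hLh, frobSq_eq_trace, frobSq_eq_trace, vecCol_eq_vec, Matrix.mul_smul,
    Matrix.mul_one, Matrix.smul_mul, trace_smul, smul_eq_mul]
  ring
end

section
/- For all real numbers a > 0 and x > 0, min{a, x} ≤ max{2, a} · log(1 + x). -/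
/-- Lemma D.1: for all reals `a > 0` and `x > 0`,
`min{a, x} ≤ max{2, a} · log(1 + x)`. -/
theorem stmt7 (a x : ℝ) (ha : 0 < a) (hx : 0 < x) :
    min a x ≤ max 2 a * Real.log (1 + x) := by
  have hlog := Real.le_log_one_add_of_nonneg hx.le
  have hM : 2 ≤ max 2 a := le_max_left 2 a
  have hmM : min a x ≤ max 2 a := (min_le_left a x).trans (le_max_right 2 a)
  have hmx : min a x ≤ x := min_le_right a x
  calc min a x ≤ max 2 a * (2 * x / (x + 2)) := by
        rw [← mul_div_assoc, le_div_iff₀ (by linarith)]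
        linarith [mul_le_mul_of_nonneg_right hmM hx.le, mul_le_mul_of_nonneg_right hM hx.le]
    _ ≤ max 2 a * Real.log (1 + x) := by gcongr
end

section
/- Let V be a real symmetric positive definite d×d matrix, let x₁, …, x_T ∈ ℝ^d, and define V_t = V + Σ_{s=1}^{t−1} x_s x_sᵀ for 1 ≤ t ≤ T+1 (so V₁ = V). Let k ≥ c > 0 and e > 0, and let r₁, …, r_T be real numbers satisfying 0 ≤ r_t ≤ min{ 2k, 2(k/c)·e·‖x_t‖_{V_t^{-1}} } for each t. Then Σ_{t=1}^{T} r_t ≤ 2(k/c)·e·√( T · max{2, c²/e²} · log( det(V_{T+1}) / det(V) ) ). -/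
open Matrix

/-- Weighted norm `‖x‖_A = √(xᵀ A x)`. -/
noncomputable def wnorm {d : ℕ} (A : Matrix (Fin d) (Fin d) ℝ) (x : Fin d → ℝ) : ℝ :=
  Real.sqrt (x ⬝ᵥ (A *ᵥ x))

/-- The inequality `min {a, x} ≤ max {2, a} log (1 + x)` for `x ≥ 0`. -/
lemma min_le_max_two_mul_log_one_add (a : ℝ) {x : ℝ} (hx : 0 ≤ x) :
    min a x ≤ max 2 a * Real.log (1 + x) := by
  have hlog : 2 * x / (x + 2) ≤ Real.log (1 + x) := Real.le_log_one_add_of_nonneg hx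
  have hlog0 : 0 ≤ Real.log (1 + x) := Real.log_nonneg (by linarith)
  rcases le_total x 2 with h | h
  · calc min a x ≤ x := min_le_right _ _
      _ ≤ 2 * (2 * x / (x + 2)) := by
        rw [← mul_div_assoc, le_div_iff₀ (by linarith)]
        nlinarith
      _ ≤ 2 * Real.log (1 + x) := by linarith
      _ ≤ max 2 a * Real.log (1 + x) := by gcongr; exact le_max_left _ _
  · have hone : 1 ≤ Real.log (1 + x) := by
      refine le_trans ?_ hlog
      rw [le_div_iff₀ (by linarith)]
      linarith
    calc min a x ≤ max 2 a := (min_le_left _ _).trans (le_max_right _ _)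
      _ ≤ max 2 a * Real.log (1 + x) :=
        le_mul_of_one_le_right (zero_le_two.trans (le_max_left _ _)) hone

/-- Matrix determinant lemma for a symmetric rank-one update. -/
lemma det_add_vecMulVec_self {n R : Type*} [Fintype n] [DecidableEq n] [CommRing R]
    {A : Matrix n n R} (hA : IsUnit A.det) (x : n → R) :
    (A + vecMulVec x x).det = A.det * (1 + x ⬝ᵥ (A⁻¹ *ᵥ x)) := by
  rw [vecMulVec_eq Unit, det_add_replicateCol_mul_replicateRow hA, Matrix.mul_assoc,
    ← replicateCol_mulVec, replicateRow_mul_replicateCol]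
  simp

lemma posDef_add_sum_vecMulVec_self {n ι : Type*} [Fintype n] {V : Matrix n n ℝ}
    (hV : V.PosDef) (s : Finset ι) (x : ι → n → ℝ) :
    (V + ∑ i ∈ s, vecMulVec (x i) (x i)).PosDef :=
  hV.add_posSemidef <| posSemidef_sum s fun i _ => by
    simpa using posSemidef_vecMulVec_self_star (x i)

/-- The elliptical potential identity. -/
lemma sum_log_one_add_eq_log_det_div {n : Type*} [Fintype n] [DecidableEq n]
    {V : Matrix n n ℝ} (hV : V.PosDef) (x : ℕ → n → ℝ) (T : ℕ) :
    ∑ t ∈ Finset.range T, Real.log (1 + x t ⬝ᵥ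
        ((V + ∑ s ∈ Finset.range t, vecMulVec (x s) (x s))⁻¹ *ᵥ x t)) =
      Real.log ((V + ∑ s ∈ Finset.range T, vecMulVec (x s) (x s)).det / V.det) := by
  induction T with
  | zero => simp [hV.det_pos.ne']
  | succ T ih =>
    have hT := posDef_add_sum_vecMulVec_self hV (Finset.range T) x
    have hdet := det_add_vecMulVec_self hT.det_pos.ne'.isUnit (x T)
    have hpos : 0 ≤ x T ⬝ᵥ
        ((V + ∑ s ∈ Finset.range T, vecMulVec (x s) (x s))⁻¹ *ᵥ x T) := by
      simpa using hT.inv.posSemidef.dotProduct_mulVec_nonneg (x T)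
    rw [Finset.sum_range_succ, ih, Finset.sum_range_succ, ← add_assoc, hdet, mul_div_right_comm,
      Real.log_mul (div_pos hT.det_pos hV.det_pos).ne' (by linarith)]

/-- deterministic regret-summation bound: with `V` symmetric
positive definite, `V_t = V + Σ_{s<t} x_s x_sᵀ` (zero-based, so `V_0 = V` and
`V_T` plays the role of the one-based `V_{T+1}`), `k ≥ c > 0`, `e > 0`, and
`0 ≤ r_t ≤ min{2k, 2(k/c)e‖x_t‖_{V_t⁻¹}}` for each `t < T`,
`Σ_{t<T} r_t ≤ 2(k/c)e √(T · max{2, c²/e²} · log(det V_T / det V))`. -/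
theorem stmt17 (d T : ℕ) (V : Matrix (Fin d) (Fin d) ℝ) (hV : V.PosDef)
    (x : ℕ → Fin d → ℝ)
    (Vt : ℕ → Matrix (Fin d) (Fin d) ℝ)
    (hVt : ∀ t, Vt t = V + ∑ s ∈ Finset.range t, Matrix.vecMulVec (x s) (x s))
    (k c e : ℝ) (hck : c ≤ k) (hc : 0 < c) (he : 0 < e)
    (r : ℕ → ℝ)
    (hr : ∀ t ∈ Finset.range T,
      0 ≤ r t ∧ r t ≤ min (2 * k) (2 * (k / c) * e * wnorm (Vt t)⁻¹ (x t))) :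
    ∑ t ∈ Finset.range T, r t ≤
      2 * (k / c) * e *
        Real.sqrt ((T : ℝ) * max 2 (c ^ 2 / e ^ 2) * Real.log ((Vt T).det / V.det)) := by
  set a : ℝ := 2 * (k / c) * e with ha
  have hk : 0 < k := hc.trans_le hck
  have ha0 : 0 < a := by positivity
  set q : ℕ → ℝ := fun t => x t ⬝ᵥ ((Vt t)⁻¹ *ᵥ x t) with hq
  have hq0 (t : ℕ) : 0 ≤ q t := by
    have hpd := posDef_add_sum_vecMulVec_self hV (Finset.range t) x
    rw [← hVt] at hpd
    simpa using hpd.inv.posSemidef.dotProduct_mulVec_nonneg (x t)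
  have hlog : ∑ t ∈ Finset.range T, Real.log (1 + q t) = Real.log ((Vt T).det / V.det) := by
    simpa only [hq, hVt] using sum_log_one_add_eq_log_det_div hV x T
  have hr2 : ∀ t ∈ Finset.range T,
      r t ^ 2 ≤ a ^ 2 * (max 2 (c ^ 2 / e ^ 2) * Real.log (1 + q t)) := by
    intro t ht
    obtain ⟨hr0, hrt⟩ := hr t ht
    refine le_trans ?_ (mul_le_mul_of_nonneg_left
      (min_le_max_two_mul_log_one_add (c ^ 2 / e ^ 2) (hq0 t)) (sq_nonneg a))
    rw [mul_min_of_nonneg _ _ (sq_nonneg a)]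
    refine le_min ?_ ?_
    · calc r t ^ 2 ≤ (2 * k) ^ 2 := by gcongr; exact hrt.trans (min_le_left _ _)
        _ = a ^ 2 * (c ^ 2 / e ^ 2) := by rw [ha]; field_simp
    · calc r t ^ 2 ≤ (a * √(q t)) ^ 2 := by gcongr; exact hrt.trans (min_le_right _ _)
        _ = a ^ 2 * q t := by rw [mul_pow, Real.sq_sqrt (hq0 t)]
  have hsum : (∑ t ∈ Finset.range T, r t) ^ 2 ≤
      a ^ 2 * (T * max 2 (c ^ 2 / e ^ 2) * Real.log ((Vt T).det / V.det)) := by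
    calc (∑ t ∈ Finset.range T, r t) ^ 2 ≤ T * ∑ t ∈ Finset.range T, r t ^ 2 := by
          simpa using sq_sum_le_card_mul_sum_sq (s := Finset.range T) (f := r)
      _ ≤ T * ∑ t ∈ Finset.range T,
          a ^ 2 * (max 2 (c ^ 2 / e ^ 2) * Real.log (1 + q t)) := by
          gcongr with t ht
          exact hr2 t ht
      _ = a ^ 2 * (T * max 2 (c ^ 2 / e ^ 2) * Real.log ((Vt T).det / V.det)) := by
          rw [← Finset.mul_sum, ← Finset.mul_sum, hlog]
          ring
  calc ∑ t ∈ Finset.range T, r t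
      ≤ √(a ^ 2 * (T * max 2 (c ^ 2 / e ^ 2) * Real.log ((Vt T).det / V.det))) :=
        Real.le_sqrt_of_sq_le hsum
    _ = _ := by rw [Real.sqrt_mul (sq_nonneg a), Real.sqrt_sq ha0.le]
end
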